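/- Let κ be a positive integer and p a nonnegative integer. Suppose u : ℂ×ℍ → ℂ is holomorphic in each variable and satisfies the KZB heat equation with parameters κ, p at every (λ,τ) ∈ ℂ×ℍ with ϑ₁(λ,τ) ≠ 0. Then the function Bu(λ,τ) = e^{πiκ(λ+τ/2)} u(λ+τ, τ) also satisfies the KZB heat equation with parameters κ, p at every (λ,τ) ∈ ℂ×ℍ with ϑ₁(λ,τ) ≠ 0. -/

import Mathlib

open Complex

/-- The complex number π. -/
noncomputable def cπ : ℂ := Real.pi

/-- The first Jacobi theta function
`ϑ₁(λ,τ) = 2 q^{1/8} sin(πλ) ∏_{j≥1} (1-q^j e^{2πiλ})(1-q^j e^{-2πiλ})(1-q^j)`, `q = e^{2πiτ}`. -/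
noncomputable def JTheta1 (z τ : ℂ) : ℂ :=
  2 * exp (cπ * I * τ / 4) * sin (cπ * z) *
    ∏' n : ℕ, ((1 - exp (2 * cπ * I * τ) ^ (n + 1) * exp (2 * cπ * I * z)) *
      (1 - exp (2 * cπ * I * τ) ^ (n + 1) * exp (-(2 * cπ * I * z))) *
      (1 - exp (2 * cπ * I * τ) ^ (n + 1)))

/-- The Dedekind eta function `η(τ) = q^{1/24} ∏_{j≥1} (1-q^j)`, `q = e^{2πiτ}`. -/
noncomputable def DEta (τ : ℂ) : ℂ :=
  exp (cπ * I * τ / 12) * ∏' n : ℕ, (1 - exp (2 * cπ * I * τ) ^ (n + 1))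

/-- The theta function of level κ:
`θ_{κ,n}(λ,τ) = Σ_{j∈ℤ} exp(2πiκ(j+n/(2κ))²τ + 2πiκ(j+n/(2κ))λ)`. -/
noncomputable def ThetaKN (κ : ℕ) (n : ℤ) (z τ : ℂ) : ℂ :=
  ∑' j : ℤ, exp (2 * cπ * I * (κ : ℂ) * ((j : ℂ) + (n : ℂ) / (2 * (κ : ℂ))) ^ 2 * τ +
    2 * cπ * I * (κ : ℂ) * ((j : ℂ) + (n : ℂ) / (2 * (κ : ℂ))) * z)

/-- The symmetrization `θ^s_{κ,n}(λ,τ) = θ_{κ,n}(λ,τ) + θ_{κ,n}(-λ,τ)`. -/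
noncomputable def ThetaS (κ : ℕ) (n : ℤ) (z τ : ℂ) : ℂ :=
  ThetaKN κ n z τ + ThetaKN κ n (-z) τ

/-- `ρ(λ,τ) = ϑ₁'(λ,τ)/ϑ₁(λ,τ)` (derivative in the first argument). -/
noncomputable def Rho (z τ : ℂ) : ℂ :=
  deriv (fun w => JTheta1 w τ) z / JTheta1 z τ

/-- `ρ'(λ,τ)`, the derivative of `ρ` in the first argument. -/
noncomputable def Rho' (z τ : ℂ) : ℂ := deriv (fun w => Rho w τ) z

/-- `u` satisfies the KZB heat equation with parameters `κ`, `p` at `(λ,τ)`: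
`2πiκ ∂u/∂τ = ∂²u/∂λ² + p(p+1)ρ'(λ,τ)u`. -/
def KZB (κ p : ℕ) (u : ℂ → ℂ → ℂ) (z τ : ℂ) : Prop :=
  2 * cπ * I * (κ : ℂ) * deriv (fun t => u z t) τ =
    iteratedDeriv 2 (fun w => u w τ) z + (p : ℂ) * ((p : ℂ) + 1) * Rho' z τ * u z τ


namespace HartogsAux
open MeasureTheory Metric Set Filter Topology

lemma log_le_circleAverage (g : ℂ → ℂ) (c : ℂ) (r : ℝ) (hr : 0 < r)
    (hg : AnalyticOnNhd ℂ g (closedBall c r)) (h0 : g c ≠ 0) :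
    Real.log ‖g c‖ ≤ Real.circleAverage (fun z => Real.posLog ‖g z‖) c r := by
  have habs : |r| = r := abs_of_pos hr
  have hg' : AnalyticOnNhd ℂ g (closedBall c |r|) := by rwa [habs]
  have J := hg'.circleAverage_log_norm hr.ne' h0
  have hs : MeromorphicOn g (sphere c |r|) :=
    (hg'.mono sphere_subset_closedBall).meromorphicOn
  have h1 : Real.circleAverage (fun z => Real.log ‖g z‖) c r
      ≤ Real.circleAverage (fun z => Real.posLog ‖g z‖) c r := by
    apply Real.circleAverage_mono hs.circleIntegrable_log_norm hs.circleIntegrable_posLog_norm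
    intro x _
    exact le_max_right _ _
  have h2 : 0 ≤ ∑ᶠ u, (MeromorphicOn.divisor g (closedBall c |r|) u : ℝ)
      * Real.log (r * ‖c - u‖⁻¹) := by
    apply finsum_nonneg
    intro u
    by_cases hu : u ∈ closedBall c |r|
    · have hd : 0 ≤ MeromorphicOn.divisor g (closedBall c |r|) u := by
        have := MeromorphicOn.AnalyticOnNhd.divisor_nonneg hg' u
        simpa using this
      by_cases hcu : c = u
      · subst hcu; simp
      apply mul_nonneg (by exact_mod_cast hd)
      apply Real.log_nonneg
      rw [habs, mem_closedBall, dist_comm, dist_eq_norm] at hu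
      have : 0 < ‖c - u‖ := norm_pos_iff.2 (sub_ne_zero.2 hcu)
      rw [← div_eq_mul_inv, le_div_iff₀ this]
      linarith
    · simp [hu]
  linarith

lemma submean (g : ℂ → ℂ) (c : ℂ) (s : ℝ) (hs : 0 < s)
    (hg : AnalyticOnNhd ℂ g (closedBall c s)) (h0 : g c ≠ 0) :
    ENNReal.ofReal (s / 2) * (ENNReal.ofReal (s / 2) *
      ENNReal.ofReal (2 * Real.pi * Real.log ‖g c‖)) ≤
      ∫⁻ p in ball c s, ENNReal.ofReal (Real.posLog ‖g p‖) := by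
  set F : ℂ → ENNReal := fun p => (ball (0:ℂ) s).indicator
    (fun p => ENNReal.ofReal (Real.posLog ‖g (c + p)‖)) p with hF
  have hcont : ContinuousOn (fun p : ℂ => ENNReal.ofReal (Real.posLog ‖g (c + p)‖)) (ball 0 s) := by
    apply ENNReal.continuous_ofReal.comp_continuousOn
    apply Real.continuous_posLog.comp_continuousOn
    apply ContinuousOn.norm
    refine hg.continuousOn.comp (by fun_prop) ?_
    intro p hp
    simp at hp ⊢; exact hp.le
  have hFm : Measurable F := by
    classical
    have := hcont.measurable_piecewise (g := 0) (s := ball (0:ℂ) s)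
      continuousOn_const measurableSet_ball
    rwa [Set.piecewise_eq_indicator] at this
  have e1 : ∫⁻ p in ball c s, ENNReal.ofReal (Real.posLog ‖g p‖) = ∫⁻ p, F p := by
    rw [← lintegral_indicator measurableSet_ball, ← lintegral_add_left_eq_self _ c]
    congr 1
    ext p
    simp [hF, indicator]
  rw [e1, ← Complex.lintegral_comp_polarCoord_symm]
  have e2 : polarCoord.target = Ioi (0 : ℝ) ×ˢ Ioo (-Real.pi) Real.pi := rfl
  rw [e2, Measure.volume_eq_prod, ← Measure.prod_restrict, lintegral_prod]
  swap
  · apply Measurable.aemeasurable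
    have : Measurable fun p : ℝ × ℝ => Complex.polarCoord.symm p := by
      simp only [Complex.polarCoord_symm_apply]
      fun_prop
    simp only [smul_eq_mul]
    exact (ENNReal.measurable_ofReal.comp measurable_fst).mul (hFm.comp this)
  have inner : ∀ r ∈ Ioo (s/2) s, ENNReal.ofReal (s / 2) *
      ENNReal.ofReal (2 * Real.pi * Real.log ‖g c‖) ≤
      ∫⁻ y in Ioo (-Real.pi) Real.pi, ENNReal.ofReal (r, y).1 • F (Complex.polarCoord.symm (r, y)) := by
    intro r hr
    have hr0 : 0 < r := by linarith [hr.1]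
    have hgr : AnalyticOnNhd ℂ g (closedBall c r) := hg.mono (closedBall_subset_closedBall hr.2.le)
    have key := log_le_circleAverage g c r hr0 hgr h0
    have hint : CircleIntegrable (fun z => Real.posLog ‖g z‖) c r := by
      apply MeromorphicOn.circleIntegrable_posLog_norm
      rw [abs_of_pos hr0]
      exact (hgr.mono sphere_subset_closedBall).meromorphicOn
    simp only [smul_eq_mul]
    rw [lintegral_const_mul' _ _ ENNReal.ofReal_ne_top]
    gcongr
    · exact hr.1.le
    have hpt : ∀ y : ℝ, F (Complex.polarCoord.symm (r, y)) =
        ENNReal.ofReal (Real.posLog ‖g (circleMap c r y)‖) := by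
      intro y
      have e3 : Complex.polarCoord.symm (r, y) = (r : ℂ) * exp (y * I) := by
        rw [Complex.polarCoord_symm_apply, Complex.exp_mul_I]; simp
      rw [e3, hF]
      simp only [circleMap]
      rw [indicator_of_mem]
      simp [Complex.norm_exp_ofReal_mul_I, abs_of_pos hr0, hr.2]
    simp_rw [hpt]
    have hcm : ∀ y : ℝ, circleMap c r y ∈ closedBall c r := fun y => 
      circleMap_mem_closedBall c hr0.le y
    have hcc : Continuous (fun y : ℝ => Real.posLog ‖g (circleMap c r y)‖) := by
      apply Real.continuous_posLog.comp
      apply Continuous.norm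
      exact hgr.continuousOn.comp_continuous (continuous_circleMap c r) hcm
    rw [← ofReal_integral_eq_lintegral_ofReal]
    rotate_left
    · exact (hcc.continuousOn.integrableOn_compact (isCompact_Icc (a := -Real.pi) (b := Real.pi))).mono_set Ioo_subset_Icc_self
    · exact Eventually.of_forall fun _ => Real.posLog_nonneg
    apply ENNReal.ofReal_le_ofReal
    rw [← integral_Ioc_eq_integral_Ioo, ← intervalIntegral.integral_of_le (by linarith [Real.pi_pos])]
    rw [Real.circleAverage_eq_integral_add (-Real.pi)] at key
    rw [intervalIntegral.integral_comp_add_right (fun θ => Real.posLog ‖g (circleMap c r θ)‖)] at key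
    have e4 : (0:ℝ) + -Real.pi = -Real.pi := by ring
    have e5 : 2 * Real.pi + -Real.pi = Real.pi := by ring
    rw [e4, e5, smul_eq_mul, inv_mul_eq_div, le_div_iff₀ (by positivity)] at key
    linarith
  calc _ = ∫⁻ r in Ioo (s/2) s, ENNReal.ofReal (s / 2) *
      ENNReal.ofReal (2 * Real.pi * Real.log ‖g c‖) := by
        rw [setLIntegral_const, Real.volume_Ioo]
        rw [mul_comm]
        congr 2; ring
    _ ≤ ∫⁻ r in Ioo (s/2) s, ∫⁻ y in Ioo (-Real.pi) Real.pi, ENNReal.ofReal (r, y).1 • F (Complex.polarCoord.symm (r, y)) := 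
        setLIntegral_mono' measurableSet_Ioo inner
    _ ≤ _ := lintegral_mono_set (fun x hx => by
        have := hx.1
        simp only [mem_Ioi]; linarith)

lemma hartogs_lemma (a : ℕ → ℂ → ℂ) (τ : ℂ) (s M r : ℝ) (hs : 0 < s) (hM : 1 ≤ M) (hr : 0 < r)
    (hd : ∀ n, DifferentiableOn ℂ (a n) (ball τ s))
    (hb : ∀ n, ∀ t ∈ ball τ s, ‖a n t‖ ≤ M / r ^ n)
    (hlim : ∀ t ∈ ball τ s, ∀ R : ℝ, 0 < R → Tendsto (fun n => R ^ n * ‖a n t‖) atTop (𝓝 0))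
    (R : ℝ) (hR : 0 < R) :
    ∃ C : ℝ, ∀ n, ∀ t ∈ ball τ (s / 2), ‖a n t‖ ≤ C / R ^ n := by
  -- choose S large
  set S : ℝ := 2 * R with hS
  have hS0 : 0 < S := by positivity
  set L : ℝ := Real.log M + |Real.log (S / r)| with hL
  have hL0 : 0 ≤ L := add_nonneg (Real.log_nonneg hM) (abs_nonneg _)
  set h : ℕ → ℂ → ℝ := fun n t => Real.posLog (S ^ n * ‖a n t‖) with hh
  have hhb : ∀ n, ∀ t ∈ ball τ s, h n t ≤ n * L ∨ n = 0 := by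
    intro n t ht
    rcases Nat.eq_zero_or_pos n with h0 | hn
    · right; exact h0
    left
    have hn1 : (1:ℝ) ≤ n := by exact_mod_cast hn
    have h1 : S ^ n * ‖a n t‖ ≤ M * (S / r) ^ n := by
      calc S ^ n * ‖a n t‖ ≤ S ^ n * (M / r ^ n) := by gcongr; exact hb n t ht
        _ = _ := by rw [div_pow]; ring
    simp only [hh, Real.posLog]
    apply max_le (by positivity)
    by_cases hz : S ^ n * ‖a n t‖ = 0
    · rw [hz, Real.log_zero]; positivity
    have hp : 0 < S ^ n * ‖a n t‖ := lt_of_le_of_ne (by positivity) (Ne.symm hz)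
    calc Real.log (S ^ n * ‖a n t‖) ≤ Real.log (M * (S / r) ^ n) := Real.log_le_log hp h1
      _ = Real.log M + n * Real.log (S / r) := by
        rw [Real.log_mul (by positivity) (by positivity), Real.log_pow]
      _ ≤ n * Real.log M + n * |Real.log (S / r)| := by
        have := Real.log_nonneg hM
        have h3 := le_abs_self (Real.log (S/r))
        nlinarith
      _ = n * L := by rw [hL]; ring
  -- dominated convergence
  have hT : Tendsto (fun n : ℕ => ∫⁻ t in ball τ s, ENNReal.ofReal (h (n+1) t / ((n:ℝ)+1))) atTop
      (𝓝 (∫⁻ t in ball τ s, 0)) := by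
    apply tendsto_lintegral_of_dominated_convergence' (fun _ => ENNReal.ofReal L)
    · intro n
      have : ContinuousOn (fun t => ENNReal.ofReal (h (n+1) t / ((n:ℝ)+1))) (ball τ s) := by
        apply ENNReal.continuous_ofReal.comp_continuousOn
        apply ContinuousOn.div_const
        apply Real.continuous_posLog.comp_continuousOn
        exact continuousOn_const.mul (hd (n+1)).continuousOn.norm
      exact this.aemeasurable measurableSet_ball
    · intro n
      filter_upwards [ae_restrict_mem measurableSet_ball] with t ht
      apply ENNReal.ofReal_le_ofReal
      rcases hhb (n+1) t ht with h1 | h1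
      · rw [div_le_iff₀ (by positivity)]
        push_cast at h1; linarith
      · omega
    · rw [setLIntegral_const]
      exact ENNReal.mul_ne_top ENNReal.ofReal_ne_top measure_ball_lt_top.ne
    · filter_upwards [ae_restrict_mem measurableSet_ball] with t ht
      have := (hlim t ht S hS0).comp (tendsto_add_atTop_nat 1)
      have h1 := this.eventually_lt_const (show (0:ℝ) < 1 by norm_num)
      apply tendsto_const_nhds.congr'
      filter_upwards [h1] with n hn
      have : h (n+1) t = 0 := by
        simp only [hh]
        rw [Real.posLog_eq_zero_iff, abs_le]
        constructor
        · have : 0 ≤ S ^ (n+1) * ‖a (n+1) t‖ := by positivity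
          linarith
        · exact hn.le
      simp [this]
  rw [lintegral_zero] at hT
  set s' : ℝ := s / 4 with hs'
  have hs'0 : 0 < s' := by positivity
  set ε : ℝ := s' / 2 * (s' / 2 * (2 * Real.pi * Real.log 2)) with hε
  have hlog2 : 0 < Real.log 2 := Real.log_pos (by norm_num)
  have hε0 : 0 < ε := by have := Real.pi_pos; positivity
  have hev := hT.eventually_lt_const (show (0:ENNReal) < ENNReal.ofReal ε by simpa using hε0)
  obtain ⟨N, hN⟩ := eventually_atTop.1 hev
  have main : ∀ n, N ≤ n → ∀ t ∈ ball τ (s/2), ‖a (n+1) t‖ ≤ 1 / R ^ (n+1) := by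
    intro n hn t ht
    by_contra hcon
    push Not at hcon
    have hp : 0 < ‖a (n+1) t‖ := lt_trans (by positivity) hcon
    have hsub : closedBall t s' ⊆ ball τ s := by
      intro x hx
      rw [mem_closedBall] at hx; rw [mem_ball] at ht ⊢
      calc dist x τ ≤ dist x t + dist t τ := dist_triangle _ _ _
        _ < s := by linarith
    have han : AnalyticOnNhd ℂ (fun x => (S:ℂ)^(n+1) * a (n+1) x) (closedBall t s') := by
      refine AnalyticOnNhd.mono ?_ hsub
      apply DifferentiableOn.analyticOnNhd _ isOpen_ball
      exact (hd (n+1)).const_mul _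
    have hsm := submean _ t s' hs'0 han (by
      have : a (n+1) t ≠ 0 := norm_pos_iff.1 hp
      have h2 : (S:ℂ) ≠ 0 := by exact_mod_cast hS0.ne'
      exact mul_ne_zero (pow_ne_zero _ h2) this)
    have hnorm : ∀ x, ‖(S:ℂ)^(n+1) * a (n+1) x‖ = S^(n+1) * ‖a (n+1) x‖ := by
      intro x; simp [abs_of_pos hS0]
    simp only [hnorm] at hsm
    have hlogbig : ((n:ℝ)+1) * Real.log 2 ≤ Real.log (S ^ (n+1) * ‖a (n+1) t‖) := by
      have : (2:ℝ)^(n+1) ≤ S ^ (n+1) * ‖a (n+1) t‖ := by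
        rw [div_lt_iff₀ (by positivity)] at hcon
        rw [hS, mul_pow]
        have h2 : (0:ℝ) < 2^(n+1) := by positivity
        nlinarith
      calc _ = Real.log (2^(n+1)) := by rw [Real.log_pow]; push_cast; ring
        _ ≤ _ := Real.log_le_log (by positivity) this
    have h1 : ENNReal.ofReal (((n:ℝ)+1) * ε) ≤
        ∫⁻ p in ball τ s, ENNReal.ofReal (h (n+1) p) := by
      refine le_trans ?_ (hsm.trans (lintegral_mono_set (ball_subset_closedBall.trans hsub)))
      rw [← ENNReal.ofReal_mul (by positivity), ← ENNReal.ofReal_mul (by positivity)]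
      apply ENNReal.ofReal_le_ofReal
      have h3 : 0 < s'/2 * (s'/2 * (2 * Real.pi)) := by have := Real.pi_pos; positivity
      rw [hε]
      nlinarith [mul_le_mul_of_nonneg_left hlogbig h3.le]
    have h2 := hN n hn
    have h3 : ∀ p, ENNReal.ofReal (h (n+1) p) =
        ENNReal.ofReal ((n:ℝ)+1) * ENNReal.ofReal (h (n+1) p / ((n:ℝ)+1)) := by
      intro p
      rw [← ENNReal.ofReal_mul (by positivity)]
      congr 1; field_simp
    simp_rw [h3] at h1
    rw [lintegral_const_mul' _ _ ENNReal.ofReal_ne_top, ENNReal.ofReal_mul (by positivity)] at h1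
    have h4 := (ENNReal.mul_le_mul_iff_right (by simp; positivity) ENNReal.ofReal_ne_top).1 h1
    exact absurd h2 (not_lt.2 h4)
  -- combine
  refine ⟨1 + ∑ k ∈ Finset.range (N+1), M / r ^ k * R ^ k, ?_⟩
  intro n t ht
  rw [le_div_iff₀ (by positivity)]
  have hpos : ∀ k ∈ Finset.range (N+1), 0 ≤ M / r ^ k * R ^ k := fun k _ => by positivity
  by_cases hn : n < N + 1
  · have h1 := Finset.single_le_sum hpos (Finset.mem_range.2 hn)
    have h2 := hb n t (ball_subset_ball (by linarith) ht)
    have h3 : ‖a n t‖ * R ^ n ≤ M / r ^ n * R ^ n := by gcongr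
    linarith
  · obtain ⟨m, rfl⟩ : ∃ m, n = m + 1 := ⟨n - 1, by omega⟩
    have h1 := main m (by omega) t ht
    rw [le_div_iff₀ (by positivity)] at h1
    have := Finset.sum_nonneg hpos
    linarith

end HartogsAux

namespace HartogsAux
open MeasureTheory Metric Set Filter Topology

lemma deriv_param (g : ℂ → ℂ → ℂ) (z₀ τ : ℂ) (ρ s M : ℝ) (hρ : 0 < ρ)
    (h1 : ∀ t ∈ ball τ s, Differentiable ℂ (fun z => g z t))
    (h2 : ∀ z ∈ ball z₀ ρ, DifferentiableOn ℂ (g z) (ball τ s))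
    (hb : ∀ z ∈ ball z₀ ρ, ∀ t ∈ ball τ s, ‖g z t‖ ≤ M) :
    (∀ z ∈ ball z₀ (ρ / 2), DifferentiableOn ℂ (fun t => deriv (fun w => g w t) z) (ball τ s)) ∧
    (∀ z ∈ ball z₀ (ρ / 2), ∀ t ∈ ball τ s, ‖deriv (fun w => g w t) z‖ ≤ 2 * M / (ρ / 2)) := by
  have hsub : ∀ z ∈ ball z₀ (ρ / 2), ball z (ρ / 2) ⊆ ball z₀ ρ := by
    intro z hz x hx
    rw [mem_ball] at *
    calc dist x z₀ ≤ dist x z + dist z z₀ := dist_triangle _ _ _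
      _ < ρ := by linarith
  have hρ2 : 0 < ρ / 2 := by positivity
  have hmaps : ∀ z ∈ ball z₀ (ρ / 2), ∀ t ∈ ball τ s,
      MapsTo (fun w => g w t) (ball z (ρ / 2)) (closedBall (g z t) (2 * M)) := by
    intro z hz t ht x hx
    rw [mem_closedBall, dist_eq_norm]
    have a1 := hb x (hsub z hz hx) t ht
    have a2 := hb z (hsub z hz (mem_ball_self hρ2)) t ht
    calc _ ≤ ‖g x t‖ + ‖g z t‖ := norm_sub_le _ _
      _ ≤ 2 * M := by linarith
  have hds : ∀ z ∈ ball z₀ (ρ / 2), ∀ t ∈ ball τ s, ∀ x ∈ ball z (ρ / 2),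
      ‖dslope (fun w => g w t) z x‖ ≤ 2 * M / (ρ / 2) := fun z hz t ht x hx =>
    Complex.norm_dslope_le_div_of_mapsTo_ball (h1 t ht).differentiableOn (hmaps z hz t ht) hx
  refine ⟨?_, ?_⟩
  swap
  · intro z hz t ht
    have := hds z hz t ht z (mem_ball_self hρ2)
    rwa [dslope_same] at this
  intro z hz
  set K : ℝ := 2 * M / (ρ / 2) with hK
  have hest : ∀ t ∈ ball τ s, ∀ x ∈ ball z (ρ / 2),
      dist (dslope (fun w => g w t) z x) (deriv (fun w => g w t) z) ≤ 2 * K / (ρ / 2) * dist x z := by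
    intro t ht x hx
    have hd : DifferentiableOn ℂ (dslope (fun w => g w t) z) (ball z (ρ / 2)) :=
      (Complex.differentiableOn_dslope (ball_mem_nhds z hρ2)).2 (h1 t ht).differentiableOn
    have := Complex.dist_le_div_mul_dist_of_mapsTo_ball (R₂ := 2 * K) hd (by
      intro y hy
      rw [mem_closedBall, dist_eq_norm]
      have a1 := hds z hz t ht y hy
      have a2 := hds z hz t ht z (mem_ball_self hρ2)
      calc _ ≤ _ := norm_sub_le _ _
        _ ≤ 2 * K := by linarith) hx
    rwa [dslope_same] at this
  -- the approximating sequence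
  have htend : TendstoLocallyUniformlyOn (fun (h : ℂ) t => dslope (fun w => g w t) z (z + h))
      (fun t => deriv (fun w => g w t) z) (𝓝[≠] 0) (ball τ s) := by
    apply TendstoUniformlyOn.tendstoLocallyUniformlyOn
    rw [Metric.tendstoUniformlyOn_iff]
    intro ε hε
    have hlim : Tendsto (fun h : ℂ => 2 * K / (ρ / 2) * ‖h‖) (𝓝 0) (𝓝 0) := by
      have : Continuous (fun h : ℂ => 2 * K / (ρ / 2) * ‖h‖) := by fun_prop
      simpa using this.tendsto 0
    have e1 := hlim.eventually_lt_const hε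
    have e2 : ∀ᶠ h : ℂ in 𝓝 0, h ∈ ball (0:ℂ) (ρ / 2) := ball_mem_nhds 0 hρ2
    filter_upwards [nhdsWithin_le_nhds e1, nhdsWithin_le_nhds e2] with h hh1 hh2 t ht
    rw [dist_comm]
    have hx : z + h ∈ ball z (ρ / 2) := by simpa using hh2
    have := hest t ht (z + h) hx
    simp only [dist_self_add_left] at this
    linarith
  apply htend.differentiableOn _ isOpen_ball
  have e2 : ∀ᶠ h : ℂ in 𝓝 0, h ∈ ball (0:ℂ) (ρ / 2) := ball_mem_nhds 0 hρ2
  filter_upwards [nhdsWithin_le_nhds e2, self_mem_nhdsWithin] with h hh2 hne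
  have hne' : z + h ≠ z := by simpa using hne
  have hx : z + h ∈ ball z (ρ / 2) := by simpa using hh2
  have : (fun t => dslope (fun w => g w t) z (z + h)) = fun t => (z + h - z)⁻¹ • (g (z+h) t - g z t) := by
    ext t
    rw [dslope_of_ne _ hne', slope_def_module]
  rw [this]
  exact ((h2 _ (hsub z hz hx)).sub (h2 _ (hsub z hz (mem_ball_self hρ2)))).const_smul
    ((z + h - z)⁻¹)

lemma iteratedDeriv_param (g : ℂ → ℂ → ℂ) (z₀ τ : ℂ) (ρ s M : ℝ) (hρ : 0 < ρ)
    (h1 : ∀ t ∈ ball τ s, Differentiable ℂ (fun z => g z t))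
    (h2 : ∀ z ∈ ball z₀ ρ, DifferentiableOn ℂ (g z) (ball τ s))
    (hb : ∀ z ∈ ball z₀ ρ, ∀ t ∈ ball τ s, ‖g z t‖ ≤ M) (n : ℕ) :
    DifferentiableOn ℂ (fun t => iteratedDeriv n (fun w => g w t) z₀) (ball τ s) := by
  have key : ∃ ρ' M' : ℝ, 0 < ρ' ∧
      (∀ t ∈ ball τ s, Differentiable ℂ (fun z => iteratedDeriv n (fun w => g w t) z)) ∧
      (∀ z ∈ ball z₀ ρ', DifferentiableOn ℂ (fun t => iteratedDeriv n (fun w => g w t) z)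
        (ball τ s)) ∧
      (∀ z ∈ ball z₀ ρ', ∀ t ∈ ball τ s, ‖iteratedDeriv n (fun w => g w t) z‖ ≤ M') := by
    induction n with
    | zero => exact ⟨ρ, M, hρ, by simpa using h1, by simpa using h2, by simpa using hb⟩
    | succ n ih =>
      obtain ⟨ρ', M', hρ', a1, a2, a3⟩ := ih
      obtain ⟨b1, b2⟩ := deriv_param (fun z t => iteratedDeriv n (fun w => g w t) z) z₀ τ ρ' s M'
        hρ' a1 a2 a3
      refine ⟨ρ' / 2, 2 * M' / (ρ' / 2), by positivity, ?_, ?_, ?_⟩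
      rotate_left
      · simpa only [iteratedDeriv_succ] using b1
      · simpa only [iteratedDeriv_succ] using b2
      · intro t ht
        simp only [iteratedDeriv_succ]
        exact (a1 t ht).deriv
  obtain ⟨ρ', M', hρ', a1, a2, a3⟩ := key
  exact a2 z₀ (mem_ball_self hρ')

lemma local_bound (f : ℂ → ℂ → ℂ) (τ : ℂ) (s : ℝ) (hs : 0 < s)
    (h1 : ∀ t ∈ closedBall τ s, Differentiable ℂ (fun z => f z t))
    (h2 : ∀ z, ∀ t ∈ closedBall τ s, DifferentiableAt ℂ (f z) t) (c : ℂ) (A : ℝ) (hA : 0 < A) :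
    ∃ C, ∀ z ∈ ball c A, ∀ t ∈ ball τ (s / 2), ‖f z t‖ ≤ C := by
  -- Baire
  obtain ⟨m, z₀, hz₀⟩ : ∃ m : ℕ, (interior {z | ∀ t ∈ closedBall τ s, ‖f z t‖ ≤ m}).Nonempty := by
    apply nonempty_interior_of_iUnion_of_closed
    · intro m
      have : {z | ∀ t ∈ closedBall τ s, ‖f z t‖ ≤ (m:ℝ)} =
          ⋂ t ∈ closedBall τ s, {z | ‖f z t‖ ≤ m} := by ext; simp
      rw [this]
      apply isClosed_biInter
      intro t ht
      exact isClosed_le (h1 t ht).continuous.norm continuous_const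
    · rw [eq_univ_iff_forall]
      intro z
      have hc : ContinuousOn (f z) (closedBall τ s) := fun t ht =>
        (h2 z t ht).continuousAt.continuousWithinAt
      obtain ⟨B, hB⟩ := (isCompact_closedBall τ s).exists_bound_of_continuousOn hc
      obtain ⟨m, hm⟩ := exists_nat_ge B
      exact mem_iUnion.2 ⟨m, fun t ht => (hB t ht).trans hm⟩
  rw [mem_interior_iff_mem_nhds, Metric.mem_nhds_iff] at hz₀
  obtain ⟨ρ, hρ, hball⟩ := hz₀
  have hbs : ball τ s ⊆ closedBall τ s := ball_subset_closedBall
  set M : ℝ := (m:ℝ) + 1 with hM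
  have hb : ∀ z ∈ ball z₀ ρ, ∀ t ∈ ball τ s, ‖f z t‖ ≤ M := fun z hz t ht =>
    (hball hz t (hbs ht)).trans (by linarith)
  set a : ℕ → ℂ → ℂ := fun n t => ((n.factorial : ℂ))⁻¹ * iteratedDeriv n (fun w => f w t) z₀ with ha
  have hsum : ∀ t ∈ ball τ s, ∀ z, HasSum (fun n => (z - z₀) ^ n * a n t) (f z t) := by
    intro t ht z
    have := Complex.hasSum_taylorSeries_of_entire (h1 t (hbs ht)) z₀ z
    have e : (fun n : ℕ => (z - z₀) ^ n * a n t) = fun n : ℕ =>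
        ((n.factorial : ℂ))⁻¹ • (z - z₀) ^ n • iteratedDeriv n (fun w => f w t) z₀ := by
      funext n
      simp only [ha, smul_eq_mul]; ring
    rw [e]; exact this
  obtain ⟨C, hC⟩ := hartogs_lemma a τ s M (ρ / 2) hs (by rw [hM]; linarith [Nat.cast_nonneg (α := ℝ) m])
    (by positivity)
    (by
      intro n
      exact (iteratedDeriv_param f z₀ τ ρ s M hρ (fun t ht => h1 t (hbs ht))
        (fun z _ t ht => (h2 z t (hbs ht)).differentiableWithinAt) hb n).const_mul _)
    (by
      intro n t ht
      have := Complex.norm_iteratedDeriv_le_of_forall_mem_sphere_norm_le (c := z₀) (R := ρ / 2)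
        (C := M) n (by positivity) (h1 t (hbs ht)).diffContOnCl
        (fun z hz => hb z (by
          rw [mem_sphere] at hz; rw [mem_ball, hz]; linarith) t ht)
      have hf : (0:ℝ) < n.factorial := by positivity
      rw [ha]
      simp only [norm_mul, norm_inv, Complex.norm_natCast]
      rw [inv_mul_le_iff₀ hf]
      rw [mul_div_assoc] at this
      exact this)
    (by
      intro t ht R hR
      have := (hsum t ht (z₀ + R)).summable.tendsto_atTop_zero.norm
      simpa [abs_of_pos hR] using this)
    (2 * (A + dist c z₀)) (by positivity)
  refine ⟨∑' n : ℕ, |C| * (1 / 2) ^ n, ?_⟩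
  intro z hz t ht
  have ht' : t ∈ ball τ s := ball_subset_ball (by linarith) ht
  rw [← (hsum t ht' z).tsum_eq]
  have hAd : 0 < A + dist c z₀ := by positivity
  refine tsum_of_norm_bounded ((summable_geometric_of_lt_one (by norm_num) (by norm_num)).mul_left _).hasSum ?_
  intro n
  have b1 : ‖a n t‖ ≤ |C| / (2 * (A + dist c z₀)) ^ n := (hC n t ht).trans (by
    gcongr; exact le_abs_self C)
  have b2 : ‖z - z₀‖ ≤ A + dist c z₀ := by
    rw [← dist_eq_norm]
    rw [mem_ball] at hz
    linarith [dist_triangle z c z₀]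
  rw [norm_mul, norm_pow]
  calc ‖z - z₀‖ ^ n * ‖a n t‖ ≤ (A + dist c z₀) ^ n * (|C| / (2 * (A + dist c z₀)) ^ n) := by
        gcongr
    _ = |C| * (1 / 2) ^ n := by
      rw [mul_pow, div_pow]
      field_simp
      simp

lemma hasDerivAt_diag (f : ℂ → ℂ → ℂ) (z τ : ℂ) (s : ℝ) (hs : 0 < s)
    (h1 : ∀ t ∈ closedBall τ s, Differentiable ℂ (fun z => f z t))
    (h2 : ∀ z, ∀ t ∈ closedBall τ s, DifferentiableAt ℂ (f z) t) :
    HasDerivAt (fun t => f (z + t) t)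
      (deriv (fun w => f w τ) (z + τ) + deriv (f (z + τ)) τ) τ := by
  obtain ⟨C, hC⟩ := local_bound f τ s hs h1 h2 (z + τ) 2 (by norm_num)
  set σ : ℝ := s / 2 with hσ
  have hσ0 : 0 < σ := by positivity
  have hbs : ball τ σ ⊆ closedBall τ s :=
    (ball_subset_ball (by linarith)).trans ball_subset_closedBall
  have hrem : HasDerivAt (fun t => f (z + t) t - f (z + t) τ - (f (z + τ) t - f (z + τ) τ)) 0 τ := by
    rw [hasDerivAt_iff_isLittleO]
    refine Asymptotics.IsBigO.trans_isLittleO (g := fun t => ‖t - τ‖ ^ 2) ?_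
      (Asymptotics.isLittleO_pow_sub_sub τ (by norm_num))
    apply Asymptotics.IsBigO.of_bound (2 * (2 * C / σ) / 2)
    have e1 : ∀ᶠ t in 𝓝 τ, t ∈ ball τ σ := ball_mem_nhds τ hσ0
    have e2 : ∀ᶠ t in 𝓝 τ, t ∈ ball τ 2 := ball_mem_nhds τ (by norm_num)
    filter_upwards [e1, e2] with t ht ht2
    have hG : ∀ w ∈ ball (z + τ) 2, ‖f w t - f w τ‖ ≤ 2 * C / σ * dist t τ := by
      intro w hw
      rw [← dist_eq_norm]
      refine Complex.dist_le_div_mul_dist_of_mapsTo_ball (f := f w) (R₁ := σ)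
        (fun x hx => (h2 w x (hbs hx)).differentiableWithinAt) ?_ ht
      intro x hx
      rw [mem_closedBall, dist_eq_norm]
      have a1 := hC w hw x hx
      have a2 := hC w hw τ (mem_ball_self hσ0)
      calc _ ≤ _ := norm_sub_le _ _
        _ ≤ 2 * C := by linarith
    have hz : z + t ∈ ball (z + τ) 2 := by simpa using ht2
    have := Complex.dist_le_div_mul_dist_of_mapsTo_ball (f := fun w => f w t - f w τ)
      (c := z + τ) (R₁ := 2) (R₂ := 2 * (2 * C / σ * dist t τ)) (z := z + t)
      (((h1 t (hbs ht)).sub (h1 τ (hbs (mem_ball_self hσ0)))).differentiableOn) (by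
        intro x hx
        rw [mem_closedBall, dist_eq_norm]
        have a1 := hG x hx
        have a2 := hG (z + τ) (mem_ball_self (by norm_num))
        calc _ ≤ _ := norm_sub_le _ _
          _ ≤ _ := by linarith) hz
    rw [dist_add_left, dist_eq_norm, dist_eq_norm] at this
    simp only [sub_self, smul_zero, sub_zero]
    rw [norm_pow, norm_norm]
    calc _ ≤ _ := this
      _ = _ := by ring
  have hτ : τ ∈ closedBall τ s := mem_closedBall_self hs.le
  have d1 : HasDerivAt (fun t => f (z + t) τ) (deriv (fun w => f w τ) (z + τ)) τ := by
    have := ((h1 τ hτ) (z + τ)).hasDerivAt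
    exact HasDerivAt.comp_const_add z τ this
  have d2 : HasDerivAt (fun t => f (z + τ) t) (deriv (f (z + τ)) τ) τ := (h2 _ τ hτ).hasDerivAt
  have := (hrem.add d1).add (d2.sub_const (f (z + τ) τ))
  rw [zero_add] at this
  refine this.congr_of_eventuallyEq (Eventually.of_forall fun t => ?_)
  simp only [Pi.add_apply]
  ring

end HartogsAux

namespace ThetaAux
open Filter Topology Metric Set

noncomputable def P (q x : ℂ) : ℂ := ∏' n : ℕ, (1 - q ^ (n + 1) * x)

lemma mult (q x : ℂ) (hq : ‖q‖ < 1) : Multipliable (fun n : ℕ => 1 - q ^ (n + 1) * x) := by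
  have : Summable (fun n : ℕ => ‖-(q ^ (n + 1) * x)‖) := by
    simp only [norm_neg, norm_mul, norm_pow]
    exact ((summable_nat_add_iff 1).2
      (summable_geometric_of_lt_one (norm_nonneg q) hq)).mul_right _
  have h := multipliable_one_add_of_summable this
  simpa only [← sub_eq_add_neg] using h

lemma P_shift (q x : ℂ) (hq : ‖q‖ < 1) : P q x = (1 - q * x) * P q (q * x) := by
  have e : ∀ n : ℕ, 1 - q ^ (n + 1) * (q * x) = 1 - q ^ (n + 1 + 1) * x := fun n => by ring
  have := tprod_eq_zero_mul' (f := fun n : ℕ => 1 - q ^ (n + 1) * x) (by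
    simpa only [e] using mult q (q * x) hq)
  unfold P
  rw [this]
  simp only [e]
  simp

lemma P_diff (q : ℂ) (hq : ‖q‖ < 1) : Differentiable ℂ (P q) := by
  intro x
  have hx : x ∈ ball (0:ℂ) (‖x‖ + 1) := by simp
  have hsum : Summable (fun n : ℕ => ‖q‖ ^ (n + 1) * (‖x‖ + 1)) :=
    ((summable_nat_add_iff 1).2 (summable_geometric_of_lt_one (norm_nonneg q) hq)).mul_right _
  have h := Summable.hasProdLocallyUniformlyOn_nat_one_add
    (f := fun (n : ℕ) (y : ℂ) => -(q ^ (n + 1) * y))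
    (K := ball (0:ℂ) (‖x‖ + 1)) isOpen_ball hsum (Eventually.of_forall fun n y hy => by
      rw [mem_ball_zero_iff] at hy
      rw [norm_neg, norm_mul, norm_pow]
      gcongr) (fun n => by fun_prop)
  have hfin : ∀ A : Finset ℕ, DifferentiableOn ℂ
      (fun y : ℂ => ∏ n ∈ A, (1 + -(q ^ (n + 1) * y))) (ball (0:ℂ) (‖x‖ + 1)) := by
    intro A
    apply DifferentiableOn.fun_finsetProd
    intro n _
    fun_prop
  have hl := hasProdLocallyUniformlyOn_iff_tendstoLocallyUniformlyOn.1 h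
  have hd := hl.differentiableOn (Eventually.of_forall hfin) isOpen_ball
  have := hd.differentiableAt (isOpen_ball.mem_nhds hx)
  have e : P q = fun x : ℂ => ∏' i : ℕ, (1 + -(q ^ (i + 1) * x)) := by
    funext y
    simp only [P, sub_eq_add_neg]
  rw [e]
  exact this

lemma norm_q (τ : ℂ) (hτ : 0 < τ.im) : ‖exp (2 * cπ * I * τ)‖ < 1 := by
  rw [Complex.norm_exp]
  have : (2 * cπ * I * τ).re = -(2 * Real.pi * τ.im) := by
    simp [cπ]
  rw [this, Real.exp_lt_one_iff]
  have := Real.pi_pos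
  have : 0 < 2 * Real.pi * τ.im := by positivity
  linarith

lemma J_eq (z τ : ℂ) (hτ : 0 < τ.im) : JTheta1 z τ =
    2 * exp (cπ * I * τ / 4) * sin (cπ * z) *
      (P (exp (2 * cπ * I * τ)) (exp (2 * cπ * I * z)) *
       P (exp (2 * cπ * I * τ)) (exp (-(2 * cπ * I * z))) *
       P (exp (2 * cπ * I * τ)) 1) := by
  have hq := norm_q τ hτ
  unfold JTheta1 P
  rw [← (mult _ _ hq).tprod_mul (mult _ _ hq),
    ← ((mult _ _ hq).mul (mult _ _ hq)).tprod_mul (mult _ _ hq)]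
  simp only [mul_one]

lemma J_diff (τ : ℂ) (hτ : 0 < τ.im) : Differentiable ℂ (fun z => JTheta1 z τ) := by
  have e : (fun z => JTheta1 z τ) = _ := funext fun z => J_eq z τ hτ
  rw [e]
  have hP := P_diff _ (norm_q τ hτ)
  have a1 : Differentiable ℂ (fun z : ℂ => P (exp (2 * cπ * I * τ)) (exp (2 * cπ * I * z))) :=
    hP.comp (by fun_prop)
  have a2 : Differentiable ℂ (fun z : ℂ => P (exp (2 * cπ * I * τ)) (exp (-(2 * cπ * I * z)))) :=
    hP.comp (by fun_prop)
  fun_prop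

lemma J_shift (z τ : ℂ) (hτ : 0 < τ.im) :
    JTheta1 (z + τ) τ = -exp (-(cπ * I * (τ + 2 * z))) * JTheta1 z τ := by
  have hq := norm_q τ hτ
  rw [J_eq _ _ hτ, J_eq _ _ hτ]
  set q := exp (2 * cπ * I * τ) with hqd
  have e1 : exp (2 * cπ * I * (z + τ)) = q * exp (2 * cπ * I * z) := by
    rw [hqd, ← Complex.exp_add]; ring_nf
  have e2 : q * exp (-(2 * cπ * I * (z + τ))) = exp (-(2 * cπ * I * z)) := by
    rw [hqd, ← Complex.exp_add]; ring_nf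
  rw [e1, P_shift q (exp (-(2 * cπ * I * (z + τ)))) hq, e2, P_shift q (exp (2 * cπ * I * z)) hq]
  have key : sin (cπ * (z + τ)) * (1 - exp (-(2 * cπ * I * z))) =
      -exp (-(cπ * I * (τ + 2 * z))) * sin (cπ * z) * (1 - q * exp (2 * cπ * I * z)) := by
    have hE : exp (cπ * I * z) ≠ 0 := exp_ne_zero _
    have hT : exp (cπ * I * τ) ≠ 0 := exp_ne_zero _
    have r1 : exp (-(2 * cπ * I * z)) = (exp (cπ * I * z))⁻¹ ^ 2 := by
      rw [← Complex.exp_neg, ← Complex.exp_nat_mul]; push_cast; ring_nf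
    have r2 : exp (2 * cπ * I * z) = (exp (cπ * I * z)) ^ 2 := by
      rw [← Complex.exp_nat_mul]; push_cast; ring_nf
    have r3 : q = (exp (cπ * I * τ)) ^ 2 := by
      rw [hqd, ← Complex.exp_nat_mul]; push_cast; ring_nf
    have r4 : exp (-(cπ * I * (τ + 2 * z))) = (exp (cπ * I * τ))⁻¹ * (exp (cπ * I * z))⁻¹ ^ 2 := by
      rw [← Complex.exp_neg, ← Complex.exp_neg, ← Complex.exp_nat_mul, ← Complex.exp_add]
      push_cast; ring_nf
    have r5 : sin (cπ * z) = ((exp (cπ * I * z))⁻¹ - exp (cπ * I * z)) * I / 2 := by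
      rw [Complex.sin, ← Complex.exp_neg]; ring_nf
    have r6 : sin (cπ * (z + τ)) = ((exp (cπ * I * z))⁻¹ * (exp (cπ * I * τ))⁻¹
        - exp (cπ * I * z) * exp (cπ * I * τ)) * I / 2 := by
      rw [Complex.sin, ← Complex.exp_neg, ← Complex.exp_neg, ← Complex.exp_add, ← Complex.exp_add]
      ring_nf
    rw [r1, r2, r3, r4, r5, r6]
    field_simp
    ring
  linear_combination (2 * exp (cπ * I * τ / 4) * P q (q * exp (2 * cπ * I * z)) *
    P q (exp (-(2 * cπ * I * z))) * P q 1) * key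

lemma J_shift_ne (z τ : ℂ) (hτ : 0 < τ.im) (h : JTheta1 z τ ≠ 0) : JTheta1 (z + τ) τ ≠ 0 := by
  rw [J_shift z τ hτ]
  exact mul_ne_zero (neg_ne_zero.2 (exp_ne_zero _)) h

lemma Rho_shift (z τ : ℂ) (hτ : 0 < τ.im) (h : JTheta1 z τ ≠ 0) :
    Rho (z + τ) τ = Rho z τ - 2 * cπ * I := by
  unfold Rho
  have d0 := ((J_diff τ hτ) z).hasDerivAt
  have d1 : HasDerivAt (fun w : ℂ => -exp (-(cπ * I * (τ + 2 * w))))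
      (-(exp (-(cπ * I * (τ + 2 * z))) * (-(cπ * I * 2)))) z := by
    have : HasDerivAt (fun w : ℂ => -(cπ * I * (τ + 2 * w))) (-(cπ * I * 2)) z := by
      have := ((((hasDerivAt_id z).const_mul 2).const_add τ).const_mul (cπ * I)).fun_neg
      simpa using this
    exact this.cexp.neg
  have d2 := d1.mul d0
  have e : deriv (fun w => JTheta1 w τ) (z + τ) = deriv (fun w => JTheta1 (w + τ) τ) z := by
    rw [deriv_comp_add_const (f := fun w => JTheta1 w τ)]
  have e' : (fun w => JTheta1 (w + τ) τ) =
      (fun w : ℂ => -exp (-(cπ * I * (τ + 2 * w)))) * (fun w => JTheta1 w τ) :=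
    funext fun w => J_shift w τ hτ
  rw [e, e', d2.deriv, J_shift z τ hτ]
  have hE := exp_ne_zero (-(cπ * I * (τ + 2 * z)))
  field_simp
  ring

lemma Rho'_shift (z τ : ℂ) (hτ : 0 < τ.im) (h : JTheta1 z τ ≠ 0) :
    Rho' (z + τ) τ = Rho' z τ := by
  unfold Rho'
  rw [← deriv_comp_add_const (f := fun w => Rho w τ)]
  have hev : ∀ᶠ w in 𝓝 z, JTheta1 w τ ≠ 0 :=
    (J_diff τ hτ).continuous.continuousAt.eventually_ne h
  have : (fun w => Rho (w + τ) τ) =ᶠ[𝓝 z] fun w => Rho w τ - 2 * cπ * I := by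
    filter_upwards [hev] with w hw using Rho_shift w τ hτ hw
  rw [this.deriv_eq, deriv_sub_const]

end ThetaAux

/-- The transformation `B : u(λ,τ) ↦ e^{πiκ(λ+τ/2)} u(λ+τ,τ)` preserves the set of solutions
of the KZB heat equation (among functions holomorphic in each variable on `ℂ×ℍ`). -/
theorem KZB_B_invariant (κ p : ℕ) (hκ : 0 < κ) (u : ℂ → ℂ → ℂ)
    (hol : ∀ z τ : ℂ, 0 < τ.im →
      DifferentiableAt ℂ (fun w => u w τ) z ∧ DifferentiableAt ℂ (fun t => u z t) τ)
    (hu : ∀ z τ : ℂ, 0 < τ.im → JTheta1 z τ ≠ 0 → KZB κ p u z τ) :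
    ∀ z τ : ℂ, 0 < τ.im → JTheta1 z τ ≠ 0 →
      KZB κ p (fun w t => exp (cπ * I * (κ : ℂ) * (w + t / 2)) * u (w + t) t) z τ := by
  intro z τ hτ hJ
  have hE := hu (z + τ) τ hτ (ThetaAux.J_shift_ne z τ hτ hJ)
  unfold KZB at hE ⊢
  rw [ThetaAux.Rho'_shift z τ hτ hJ] at hE
  have him : ∀ t ∈ Metric.closedBall τ (τ.im / 2), 0 < t.im := by
    intro t ht
    rw [Metric.mem_closedBall, dist_eq_norm] at ht
    have h1 := (Complex.abs_im_le_norm (t - τ)).trans ht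
    rw [Complex.sub_im] at h1
    have := (abs_le.1 h1).1
    linarith
  have hdiag := HartogsAux.hasDerivAt_diag u z τ (τ.im / 2) (by positivity)
    (fun t ht w => (hol w t (him t ht)).1) (fun w t ht => (hol w t (him t ht)).2)
  set k : ℂ := cπ * I * (κ : ℂ) with hk
  have hφ : Differentiable ℂ (fun w => u w τ) := fun w => (hol w τ hτ).1
  set φ : ℂ → ℂ := fun w => u w τ with hφd
  -- derivative in τ
  have dt : HasDerivAt (fun t => exp (k * (z + t / 2)) * u (z + t) t)
      (exp (k * (z + τ / 2)) * (k * (1 / 2)) * u (z + τ) τ + exp (k * (z + τ / 2)) *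
        (deriv φ (z + τ) + deriv (u (z + τ)) τ)) τ := by
    have h1 : HasDerivAt (fun t : ℂ => exp (k * (z + t / 2)))
        (exp (k * (z + τ / 2)) * (k * (1 / 2))) τ :=
      ((((hasDerivAt_id τ).div_const 2).const_add z).const_mul k).cexp
    exact h1.mul hdiag
  -- derivatives in z
  have hexp : ∀ w : ℂ, HasDerivAt (fun w : ℂ => exp (k * (w + τ / 2)))
        (exp (k * (w + τ / 2)) * (k * 1)) w := fun w =>
      (((hasDerivAt_id w).add_const (τ / 2)).const_mul k).cexp
  have hs0 : ∀ w, HasDerivAt (fun w => φ (w + τ)) (deriv φ (w + τ)) w := fun w =>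
    HasDerivAt.comp_add_const w τ (hφ (w + τ)).hasDerivAt
  have hs1 : ∀ w, HasDerivAt (fun w => deriv φ (w + τ)) (deriv (deriv φ) (w + τ)) w := fun w =>
    HasDerivAt.comp_add_const w τ (hφ.deriv (w + τ)).hasDerivAt
  have d1 : deriv (fun w => exp (k * (w + τ / 2)) * u (w + τ) τ) =
      fun w => exp (k * (w + τ / 2)) * (k * φ (w + τ) + deriv φ (w + τ)) := by
    funext w
    have := ((hexp w).mul (hs0 w)).deriv
    rw [show (fun w => exp (k * (w + τ / 2)) * u (w + τ) τ) =
      (fun w => exp (k * (w + τ / 2))) * (fun w => φ (w + τ)) from rfl, this]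
    ring
  have d2 : iteratedDeriv 2 (fun w => exp (k * (w + τ / 2)) * u (w + τ) τ) z =
      exp (k * (z + τ / 2)) * (k * 1) * (k * φ (z + τ) + deriv φ (z + τ)) +
      exp (k * (z + τ / 2)) * (k * deriv φ (z + τ) + deriv (deriv φ) (z + τ)) := by
    rw [iteratedDeriv_succ, iteratedDeriv_one, d1]
    exact ((hexp z).mul (((hs0 z).const_mul k).add (hs1 z))).deriv
  have d3 : iteratedDeriv 2 φ (z + τ) = deriv (deriv φ) (z + τ) := by
    rw [iteratedDeriv_succ, iteratedDeriv_one]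
  rw [d3] at hE
  have hE' : 2 * k * deriv (u (z + τ)) τ = deriv (deriv φ) (z + τ) +
      (p : ℂ) * ((p : ℂ) + 1) * Rho' z τ * u (z + τ) τ := by
    rw [← hE, hk]; ring
  have hφu : φ (z + τ) = u (z + τ) τ := rfl
  have hL : 2 * cπ * I * (κ : ℂ) = 2 * k := by rw [hk]; ring
  simp only []
  rw [dt.deriv, d2, hL, hφu]
  linear_combination exp (k * (z + τ / 2)) * hE'
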